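/- Let R be a commutative noetherian ring, a a proper ideal, and X an R-module all of whose elements are killed by a power of a (a-torsion). Then X has all Ext^i_R(R/a, X) finitely generated with R/a artinian (i.e., a of finite colength) for some such ideal a if and only if X is an artinian R-module. -/

import Mathlib

open CategoryTheory

noncomputable section
universe u

/-- `Ext^i_R(M, N)`. -/
abbrev extMod (R : Type u) [CommRing R] (i : ℕ) (M N : Type u) [AddCommGroup M] [Module R M]
    [AddCommGroup N] [Module R N] : ModuleCat R :=
  ((Ext R (ModuleCat.{u} R) i).obj (Opposite.op (ModuleCat.of R M))).obj (ModuleCat.of R N)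

/-- `M` is `a`-torsion: every element is annihilated by a power of `a`. -/
def IsAdicTorsion (R : Type u) [CommRing R] (a : Ideal R) (M : Type u)
    [AddCommGroup M] [Module R M] : Prop :=
  ∀ x : M, ∃ n : ℕ, ∀ r ∈ a ^ n, r • x = 0

section Melkersson
variable {R : Type u} [CommRing R]

/-- One variable case of the Melkersson criterion. -/
lemma isArtinian_of_torsionBy {X : Type u} [AddCommGroup X] [Module R X] (t : R)
    (ht : ∀ x : X, ∃ n : ℕ, t ^ n • x = 0)
    (h : IsArtinian R (Submodule.torsionBy R X t)) : IsArtinian R X := by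
  rw [← monotone_stabilizes_iff_artinian]
  intro f
  -- `L n N = t ^ n N ∩ X[t]`
  let T : Submodule R X := Submodule.torsionBy R X t
  let L : ℕ → Submodule R X → Submodule R T := fun n N =>
    (N.map (LinearMap.lsmul R X (t ^ n))).comap T.subtype
  have memL : ∀ n N (y : T), y ∈ L n N ↔ ∃ x ∈ N, t ^ n • x = (y : X) := by
    intro n N y; simp [L, Submodule.mem_map]
  have L_mono : ∀ n {N N' : Submodule R X}, N ≤ N' → L n N ≤ L n N' := by
    intro n N N' hN y hy
    rw [memL] at hy ⊢
    obtain ⟨x, hx, e⟩ := hy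
    exact ⟨x, hN hx, e⟩
  have L_anti : ∀ {n n' : ℕ} (N : Submodule R X), n ≤ n' → L n' N ≤ L n N := by
    intro n n' N hn y hy
    rw [memL] at hy ⊢
    obtain ⟨x, hx, e⟩ := hy
    refine ⟨t ^ (n' - n) • x, N.smul_mem _ hx, ?_⟩
    rw [smul_smul, ← pow_add, Nat.add_sub_cancel' hn, e]
  have key : ∀ N N' : Submodule R X, N' ≤ N → (∀ n, L n N = L n N') → N = N' := by
    intro N N' hle hL
    refine le_antisymm ?_ hle
    have : ∀ n : ℕ, ∀ x ∈ N, t ^ n • x = 0 → x ∈ N' := by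
      intro n
      induction n with
      | zero => intro x _ h0; simp at h0; simp [h0]
      | succ n ih =>
        intro x hx h0
        have hT : t ^ n • x ∈ T := by
          rw [Submodule.mem_torsionBy_iff, smul_smul, ← pow_succ', h0]
        have : (⟨_, hT⟩ : T) ∈ L n N := (memL _ _ _).2 ⟨x, hx, rfl⟩
        rw [hL, memL] at this
        obtain ⟨x', hx', e⟩ := this
        have := ih (x - x') (N.sub_mem hx (hle hx')) (by rw [smul_sub, e]; simp)
        simpa using N'.add_mem this hx'
    intro x hx
    obtain ⟨n, hn⟩ := ht x
    exact this n x hx hn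
  -- diagonal stabilises
  obtain ⟨d, hd⟩ := monotone_stabilizes_iff_artinian.2 h
    ⟨fun k => OrderDual.toDual (L k (OrderDual.ofDual (f k))), fun i j hij =>
      (L_anti _ hij).trans (L_mono _ (f.monotone hij))⟩
  have hd' : ∀ n m, d ≤ n → d ≤ m → L n (OrderDual.ofDual (f m)) = L d (OrderDual.ofDual (f d)) := by
    intro n m hn hm
    apply le_antisymm
    · exact (L_anti _ hn).trans (L_mono _ (f.monotone hm))
    · have := hd (max n m) (hn.trans (le_max_left _ _))
      have this : L d (OrderDual.ofDual (f d)) = L (max n m) (OrderDual.ofDual (f (max n m))) := this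
      rw [this]
      exact (L_anti _ (le_max_left _ _)).trans (L_mono _ (f.monotone (le_max_right _ _)))
  have each : ∀ n, ∃ k, ∀ m, k ≤ m → L n (OrderDual.ofDual (f k)) = L n (OrderDual.ofDual (f m)) := by
    intro n
    obtain ⟨k, hk⟩ := monotone_stabilizes_iff_artinian.2 h
      ⟨fun k => OrderDual.toDual (L n (OrderDual.ofDual (f k))), fun i j hij =>
        L_mono _ (f.monotone hij)⟩
    exact ⟨k, hk⟩
  choose k hk using each
  let M := max d ((Finset.range d).sup k)
  refine ⟨M, fun m hm => ?_⟩
  refine key _ _ (f.monotone hm) fun n => ?_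
  have hdM : d ≤ M := le_max_left _ _
  by_cases hn : d ≤ n
  · exact (hd' n M hn hdM).trans (hd' n m hn (hdM.trans hm)).symm
  · have hkM : k n ≤ M := (Finset.le_sup (f := k) (Finset.mem_range.2 (not_le.1 hn))).trans
      (le_max_right _ _)
    exact (hk n M hkM).symm.trans (hk n m (hkM.trans hm))

/-- the Melkersson criterion. -/
lemma isArtinian_of_finset (S : Finset R) : ∀ (X : Type u) [AddCommGroup X] [Module R X],
    (∀ t ∈ S, ∀ x : X, ∃ n : ℕ, t ^ n • x = 0) →
    IsArtinian R (Submodule.torsionBySet R X (S : Set R)) → IsArtinian R X := by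
  classical
  induction S using Finset.induction_on with
  | empty =>
    intro X _ _ _ h
    refine isArtinian_of_injective (LinearMap.codRestrict (Submodule.torsionBySet R X
      ((∅ : Finset R) : Set R)) LinearMap.id (fun x => ?_)) (fun x y hxy => ?_)
    · simp [Submodule.mem_torsionBySet_iff]
    · simpa using congrArg Subtype.val hxy
  | insert t S ht ih =>
    intro X _ _ htor h
    refine isArtinian_of_torsionBy t (htor t (by simp)) ?_
    refine ih _ ?_ ?_
    · intro s hs x
      obtain ⟨n, hn⟩ := htor s (by simp [hs]) x
      exact ⟨n, Subtype.ext (by simpa using hn)⟩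
    · let Y := Submodule.torsionBy R X t
      let g : Submodule.torsionBySet R Y (S : Set R) →ₗ[R] X :=
        Y.subtype ∘ₗ Submodule.subtype _
      refine isArtinian_of_injective (LinearMap.codRestrict (Submodule.torsionBySet R X
        ((insert t S : Finset R) : Set R)) g (fun x => ?_)) (fun x y hxy => ?_)
      · rw [Submodule.mem_torsionBySet_iff]
        rintro ⟨r, hr⟩
        rcases Finset.mem_insert.1 (Finset.mem_coe.1 hr) with rfl | hr
        · exact x.1.2
        · have := (Submodule.mem_torsionBySet_iff _ _).1 x.2 ⟨r, hr⟩
          exact congrArg Subtype.val this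
      · have h2 : ((x : Y) : X) = ((y : Y) : X) := by
          have := congrArg (Submodule.subtype _) hxy
          exact this
        exact Subtype.ext (Subtype.ext h2)

/-- restriction of finiteness to `R/a`: a module killed by `a` with `R/a` artinian. -/
lemma isNoetherian_iff_isArtinian_of_killed (a : Ideal R) [IsArtinianRing (R ⧸ a)]
    (X : Type u) [AddCommGroup X] [Module R X] (h : ∀ r ∈ a, ∀ x : X, r • x = 0) :
    IsNoetherian R X ↔ IsArtinian R X := by
  have ht : Module.IsTorsionBySet R X a := fun x r => h r.1 r.2 x
  let _ := ht.module
  let e : X →ₛₗ[Ideal.Quotient.mk a] X := ⟨.id _, fun _ _ ↦ rfl⟩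
  rw [e.isNoetherian_iff_of_bijective Function.bijective_id,
    e.isArtinian_iff_of_bijective Function.bijective_id]
  exact IsSemiprimaryRing.isNoetherian_iff_isArtinian

end Melkersson

section Socle
variable {R : Type u} [CommRing R]

lemma isArtinianRing_quot_annihilator [IsNoetherianRing R] (S : Type u) [AddCommGroup S] [Module R S]
    [Module.Finite R S] [IsArtinian R S] : IsArtinianRing (R ⧸ Module.annihilator R S) := by
  obtain ⟨n, s, hs⟩ := Module.Finite.exists_fin (R := R) (M := S)
  let φ : R →ₗ[R] (Fin n → S) := LinearMap.pi fun i => LinearMap.toSpanSingleton R S (s i)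
  have hker : LinearMap.ker φ = Module.annihilator R S := by
    ext r
    rw [LinearMap.mem_ker, Module.mem_annihilator]
    constructor
    · intro h m
      have hm : m ∈ Submodule.span R (Set.range s) := by rw [hs]; trivial
      induction hm using Submodule.span_induction with
      | mem x hx => obtain ⟨i, rfl⟩ := hx; exact congrFun h i
      | zero => simp
      | add x y _ _ hx hy => rw [smul_add, hx, hy, add_zero]
      | smul c x _ hx => rw [smul_comm, hx, smul_zero]
    · intro h; ext i; exact h (s i)
  have h1 : IsArtinian R (R ⧸ LinearMap.ker φ) :=
    (LinearMap.quotKerEquivRange φ).symm.isArtinian_iff.1 inferInstance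
  rw [hker] at h1
  let e : R ⧸ Module.annihilator R S →ₛₗ[Ideal.Quotient.mk (Module.annihilator R S)] R ⧸ Module.annihilator R S :=
    ⟨.id _, fun _ _ ↦ rfl⟩
  exact (e.isArtinian_iff_of_bijective Function.bijective_id).1 h1

lemma exists_ideal_of_isArtinian [IsNoetherianRing R] [Nontrivial R] (X : Type u) [AddCommGroup X] [Module R X]
    [IsArtinian R X] : ∃ a : Ideal R, a ≠ ⊤ ∧ IsArtinianRing (R ⧸ a) ∧ 
      ∀ x : X, ∃ n : ℕ, ∀ r ∈ a ^ n, r • x = 0 := by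
  rcases subsingleton_or_nontrivial X with hX | hX
  · obtain ⟨m, hm⟩ := Ideal.exists_maximal R
    refine ⟨m, hm.ne_top, ?_, fun x => ⟨0, fun r _ => Subsingleton.elim _ _⟩⟩
    let _ := Ideal.Quotient.field m
    infer_instance
  let S : Submodule R X := sSup {m : Submodule R X | IsSimpleModule R m}
  have hss : IsSemisimpleModule R S := by
    have := isSemisimpleModule_biSup_of_isSemisimpleModule_submodule
      (s := {m : Submodule R X | IsSimpleModule R m}) (p := id)
      (fun i (hi : IsSimpleModule R i) => by dsimp; infer_instance)
    have hS : S = ⨆ i ∈ {m : Submodule R X | IsSimpleModule R m}, id i := sSup_eq_iSup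
    rw [hS]
    exact this
  have hfin : Module.Finite R S := by
    have h1 : IsArtinian R S := inferInstance
    exact ((IsSemisimpleModule.finite_tfae (R := R) (M := S)).out 2 0).1 h1
  have hsimple : ∀ N : Submodule R X, N ≠ ⊥ → ∃ m ≤ N, IsSimpleModule R m := by
    intro N hN
    obtain ⟨m, hm, hmN⟩ := (IsAtomic.eq_bot_or_exists_atom_le N).resolve_left hN
    exact ⟨m, hmN, isSimpleModule_iff_isAtom.2 hm⟩
  refine ⟨Module.annihilator R S, ?_, isArtinianRing_quot_annihilator S, ?_⟩
  · rw [Ne, Module.annihilator_eq_top_iff, Submodule.subsingleton_iff_eq_bot]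
    intro h0
    obtain ⟨m, -, hm⟩ := hsimple ⊤ top_ne_bot
    have h1 : m ≤ S := le_sSup hm
    rw [h0, le_bot_iff] at h1
    exact (isSimpleModule_iff_isAtom.1 hm).1 h1
  · intro x
    -- the cyclic submodule has finite length
    let I : Ideal R := Ideal.torsionOf R X x
    have hI : Module.annihilator R S ≤ I.radical := by
      intro r hr
      obtain ⟨n, hn⟩ := IsArtinian.monotone_stabilizes
        (R := R) (M := X) ⟨fun k => OrderDual.toDual (Submodule.span R {r ^ k • x}), fun i j hij => by
          change Submodule.span R {r ^ j • x} ≤ Submodule.span R {r ^ i • x}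
          rw [Submodule.span_singleton_le_iff_mem, Submodule.mem_span_singleton]
          exact ⟨r ^ (j - i), by rw [smul_smul, ← pow_add, Nat.sub_add_cancel hij]⟩⟩
      refine ⟨n, ?_⟩
      rw [Ideal.mem_torsionOf_iff]
      by_contra hne
      let N : Submodule R X := Submodule.span R {r ^ n • x}
      have hN : N = Submodule.span R {r ^ (n + 1) • x} := hn (n + 1) (by omega)
      have hsurj : Function.Surjective (LinearMap.lsmul R N r) := by
        rintro ⟨y, hy⟩
        have hy' := hy
        rw [hN, Submodule.mem_span_singleton] at hy'
        obtain ⟨c, hc⟩ := hy'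
        refine ⟨⟨c • r ^ n • x, N.smul_mem _ (Submodule.mem_span_singleton_self _)⟩, ?_⟩
        apply Subtype.ext
        change r • c • r ^ n • x = y
        rw [← hc, smul_comm r c, smul_smul r, pow_succ']
      have hNn : IsNoetherian R N := isNoetherian_span_of_finite R (Set.finite_singleton _)
      have hinj := IsNoetherian.injective_of_surjective_endomorphism _ hsurj
      have hNbot : N ≠ ⊥ := by
        rw [Ne, Submodule.span_singleton_eq_bot]; exact hne
      obtain ⟨m, hmN, hm⟩ := hsimple N hNbot
      have hmS : m ≤ S := le_sSup hm
      apply (isSimpleModule_iff_isAtom.1 hm).1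
      rw [eq_bot_iff]
      intro y hy
      have h0 : r • y = 0 := congrArg Subtype.val (Module.mem_annihilator.1 hr ⟨y, hmS hy⟩)
      have h1 : (⟨y, hmN hy⟩ : N) = 0 := by
        apply hinj
        apply Subtype.ext
        simpa using h0
      simpa using congrArg Subtype.val h1
    obtain ⟨n, hn⟩ := Ideal.exists_pow_le_of_le_radical_of_fg hI (IsNoetherian.noetherian _)
    exact ⟨n, fun r hr => (Ideal.mem_torsionOf_iff x r).1 (hn hr)⟩

end Socle

section FinRes
open Limits
variable {R : Type u} [CommRing R]

lemma exists_finCover (Z : ModuleCat.{u} R) : ∃ (P : ModuleCat.{u} R) (p : P ⟶ Z),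
    Projective P ∧ Epi p ∧ (Module.Finite R Z → Module.Finite R P) := by
  by_cases h : Module.Finite R Z
  · obtain ⟨n, f, hf⟩ := Module.Finite.exists_fin' R Z
    refine ⟨ModuleCat.of R (Fin n → R), ModuleCat.ofHom f, ?_, ?_, fun _ => ?_⟩
    · exact ModuleCat.projective_of_free (Pi.basisFun R (Fin n))
    · exact (ModuleCat.epi_iff_surjective _).2 hf
    · change Module.Finite R (Fin n → R); infer_instance
  · exact ⟨Projective.over Z, Projective.π Z, inferInstance, inferInstance, fun h' => (h h').elim⟩

def finOver (Z : ModuleCat.{u} R) : ModuleCat.{u} R := (exists_finCover Z).choose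
def finPi (Z : ModuleCat.{u} R) : finOver Z ⟶ Z := (exists_finCover Z).choose_spec.choose
instance (Z : ModuleCat.{u} R) : Projective (finOver Z) :=
  (exists_finCover Z).choose_spec.choose_spec.1
instance (Z : ModuleCat.{u} R) : Epi (finPi Z) :=
  (exists_finCover Z).choose_spec.choose_spec.2.1
lemma finite_finOver (Z : ModuleCat.{u} R) : Module.Finite R Z → Module.Finite R (finOver Z) :=
  (exists_finCover Z).choose_spec.choose_spec.2.2

def finD {X Y : ModuleCat.{u} R} (f : X ⟶ Y) : finOver (kernel f) ⟶ X := finPi _ ≫ kernel.ι f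

lemma finD_comp {X Y : ModuleCat.{u} R} (f : X ⟶ Y) : finD f ≫ f = 0 := by simp [finD]

lemma exact_finD {X Y : ModuleCat.{u} R} (f : X ⟶ Y) :
    (ShortComplex.mk (finD f) f (finD_comp f)).Exact := by
  let α : ShortComplex.mk (finD f) f (finD_comp f) ⟶ ShortComplex.mk (kernel.ι f) f (by simp) :=
    { τ₁ := finPi _
      τ₂ := 𝟙 _
      τ₃ := 𝟙 _
      comm₁₂ := by simp [finD] }
  have : Epi α.τ₁ := by change Epi (finPi _); infer_instance
  have : IsIso α.τ₂ := by change IsIso (𝟙 _); infer_instance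
  have : Mono α.τ₃ := by change Mono (𝟙 _); infer_instance
  rw [ShortComplex.exact_iff_of_epi_of_isIso_of_mono α]
  apply ShortComplex.exact_of_f_is_kernel
  apply kernelIsKernel

lemma finite_finKer [IsNoetherianRing R] {X Y : ModuleCat.{u} R} (f : X ⟶ Y) (h : Module.Finite R X) :
    Module.Finite R (finOver (kernel f)) := by
  apply finite_finOver
  have hinj := (ModuleCat.mono_iff_injective (kernel.ι f)).1 inferInstance
  exact Module.Finite.of_injective (kernel.ι f).hom hinj

/-- The sequence of differentials of the resolution by finite free modules. -/
def finSeq (Z : ModuleCat.{u} R) : ℕ → Arrow (ModuleCat.{u} R)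
  | 0 => Arrow.mk (finPi Z)
  | n + 1 => Arrow.mk (finD (finSeq Z n).hom)

def finX (Z : ModuleCat.{u} R) (n : ℕ) : ModuleCat.{u} R := (finSeq Z n).left

def finDiff (Z : ModuleCat.{u} R) (n : ℕ) : finX Z (n + 1) ⟶ finX Z n := finD (finSeq Z n).hom

lemma finDiff_comp (Z : ModuleCat.{u} R) (n : ℕ) : finDiff Z (n + 1) ≫ finDiff Z n = 0 :=
  finD_comp (finD (finSeq Z n).hom)

lemma finDiff_exact (Z : ModuleCat.{u} R) (n : ℕ) :
    (ShortComplex.mk (finDiff Z (n + 1)) (finDiff Z n) (finDiff_comp Z n)).Exact :=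
  exact_finD (finD (finSeq Z n).hom)

def finAug (Z : ModuleCat.{u} R) : finX Z 0 ⟶ Z := finPi Z

lemma finAug_comp (Z : ModuleCat.{u} R) : finDiff Z 0 ≫ finAug Z = 0 := finD_comp (finPi Z)

lemma finAug_exact (Z : ModuleCat.{u} R) :
    (ShortComplex.mk (finDiff Z 0) (finAug Z) (finAug_comp Z)).Exact := exact_finD (finPi Z)

instance (Z : ModuleCat.{u} R) : Epi (finAug Z) := inferInstanceAs (Epi (finPi Z))

instance (Z : ModuleCat.{u} R) (n : ℕ) : Projective (finX Z n) := by
  cases n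
  · exact inferInstanceAs (Projective (finOver _))
  · exact inferInstanceAs (Projective (finOver _))

lemma finX_finite [IsNoetherianRing R] (Z : ModuleCat.{u} R) (h : Module.Finite R Z) (n : ℕ) :
    Module.Finite R (finX Z n) := by
  induction n with
  | zero => exact finite_finOver _ h
  | succ n ih => exact finite_finKer (finSeq Z n).hom ih

def finComplex (Z : ModuleCat.{u} R) : ChainComplex (ModuleCat.{u} R) ℕ :=
  ChainComplex.of (finX Z) (finDiff Z) (finDiff_comp Z)

lemma finComplex_d (Z : ModuleCat.{u} R) (n : ℕ) :
    (finComplex Z).d (n + 1) n = finDiff Z n := ChainComplex.of_d _ _ _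

lemma exact_of_eq {A B C : ModuleCat.{u} R} {f f' : A ⟶ B} {g g' : B ⟶ C} (w : f ≫ g = 0)
    (w' : f' ≫ g' = 0) (hf : f = f') (hg : g = g') (h : (ShortComplex.mk f' g' w').Exact) :
    (ShortComplex.mk f g w).Exact := by
  subst hf hg; exact h

lemma finComplex_exactAt_succ (Z : ModuleCat.{u} R) (n : ℕ) :
    (finComplex Z).ExactAt (n + 1) := by
  rw [HomologicalComplex.exactAt_iff' _ (n + 1 + 1) (n + 1) n (by simp) (by simp)]
  exact exact_of_eq _ _ (finComplex_d Z (n + 1)) (finComplex_d Z n) (finDiff_exact Z n)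

instance (Z : ModuleCat.{u} R) (n : ℕ) : Projective ((finComplex Z).X n) :=
  inferInstanceAs (Projective (finX Z n))

def finResPi (Z : ModuleCat.{u} R) : finComplex Z ⟶ (ChainComplex.single₀ _).obj Z :=
  (ChainComplex.toSingle₀Equiv _ _).symm ⟨finAug Z, by
          rw [finComplex_d]; exact finAug_comp Z⟩

lemma finResPi_f_zero (Z : ModuleCat.{u} R) : (finResPi Z).f 0 = finAug Z := by
  exact ChainComplex.toSingle₀Equiv_symm_apply_f_zero _ _

instance (Z : ModuleCat.{u} R) : QuasiIso (finResPi Z) := ⟨fun n => by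
    cases n
    · rw [ChainComplex.quasiIsoAt₀_iff, ShortComplex.quasiIso_iff_of_zeros' _ ?_ ?_ ?_]
      · constructor
        · exact exact_of_eq _ _ (finComplex_d Z 0) (finResPi_f_zero Z) (finAug_exact Z)
        · change Epi ((finResPi Z).f 0)
          rw [finResPi_f_zero]
          exact inferInstanceAs (Epi (finAug Z))
      all_goals rfl
    · rw [quasiIsoAt_iff_exactAt']
      · apply finComplex_exactAt_succ
      · apply ChainComplex.exactAt_succ_single_obj⟩

def finRes (Z : ModuleCat.{u} R) : ProjectiveResolution Z where
  complex := finComplex Z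
  π := finResPi Z

end FinRes

section ExtFacts
open Limits
variable {R : Type u} [CommRing R]

lemma isArtinian_homology {ι : Type} {c : ComplexShape ι} (K : HomologicalComplex (ModuleCat.{u} R) c) (n : ι)
    (h : IsArtinian R (K.X n)) : IsArtinian R (K.homology n) := by
  have h1 : IsArtinian R (K.cycles n) := isArtinian_of_injective (K.iCycles n).hom
    ((ModuleCat.mono_iff_injective _).1 inferInstance)
  exact isArtinian_of_surjective _ (K.homologyπ n).hom
    ((ModuleCat.epi_iff_surjective _).1 inferInstance)

lemma isArtinian_linearMap (P X : Type u) [AddCommGroup P] [Module R P] [AddCommGroup X] [Module R X]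
    [Module.Finite R P] [IsArtinian R X] : IsArtinian R (P →ₗ[R] X) := by
  obtain ⟨n, f, hf⟩ := Module.Finite.exists_fin' R P
  have : IsArtinian R ((Fin n → R) →ₗ[R] X) :=
    (LinearEquiv.isArtinian_iff ((Pi.basisFun R (Fin n)).constr R (M' := X))).1 inferInstance
  exact isArtinian_of_injective (LinearMap.lcomp R X f) (fun g g' h => by
    ext x
    obtain ⟨y, rfl⟩ := hf x
    exact LinearMap.congr_fun h y)

variable {Z Y : ModuleCat.{u} R} (P : ProjectiveResolution Z)

lemma isArtinian_linearYonedaObj_X (n : ℕ) (hP : Module.Finite R (P.complex.X n)) (hY : IsArtinian R Y) :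
    IsArtinian R ((P.complex.linearYonedaObj R Y).X n) := by
  have := isArtinian_linearMap (R := R) (P.complex.X n) Y
  change IsArtinian R (P.complex.X n ⟶ Y)
  exact (LinearEquiv.isArtinian_iff (ModuleCat.homLinearEquiv (S := R))).2 this

lemma lyo_d_apply (i j : ℕ) (f : P.complex.X i ⟶ Y) :
    ((P.complex.linearYonedaObj R Y).d i j).hom f = (P.complex.d j i ≫ f : P.complex.X j ⟶ Y) := rfl

lemma killed_homology (r : R) (hr : ∀ z : Z, r • z = 0) (n : ℕ)
    (x : (P.complex.linearYonedaObj R Y).homology n) : r • x = 0 := by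
  let K := P.complex.linearYonedaObj R Y
  have hcomp : (r • 𝟙 P.complex) ≫ P.π = 0 := by
    apply HomologicalComplex.hom_ext
    intro i
    cases i with
    | zero =>
      let p : P.complex.X 0 ⟶ Z := P.π.f 0
      have hp : r • p = 0 := by
        ext x
        exact hr (p.hom x)
      have e : ((r • 𝟙 P.complex) ≫ P.π).f 0 = r • P.π.f 0 := by simp
      exact e.trans hp
    | succ i => simp
  let h := ProjectiveResolution.liftHomotopyZero (P := P) (Q := P) (r • 𝟙 P.complex) hcomp
  have hn := h.comm n
  obtain ⟨c, rfl⟩ := (ModuleCat.epi_iff_surjective (K.homologyπ n)).1 inferInstance x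
  let f : P.complex.X n ⟶ Y := (K.iCycles n).hom c
  have hf : P.complex.d (n + 1) n ≫ f = 0 := by
    have := ConcreteCategory.congr_hom (K.iCycles_d n (n + 1)) c
    exact this
  have hf' : ∀ m, P.complex.d m n ≫ f = 0 := by
    intro m
    have := ConcreteCategory.congr_hom (K.iCycles_d n m) c
    exact this
  let m := (ComplexShape.down ℕ).next n
  let g : P.complex.X m ⟶ Y := h.hom m n ≫ f
  have hg : r • f = P.complex.d n m ≫ g := by
    have e : (r • 𝟙 P.complex : P.complex ⟶ P.complex).f n ≫ f = r • f := by simp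
    rw [← e, hn]
    simp [dNext, prevD, hf', g, m]
  have hc : (K.toCycles m n).hom g = r • c := by
    apply (ModuleCat.mono_iff_injective (K.iCycles n)).1 inferInstance
    have := ConcreteCategory.congr_hom (K.toCycles_i m n) g
    refine this.trans ?_
    refine Eq.trans ?_ (map_smul (K.iCycles n).hom r c).symm
    exact hg.symm
  have h0 := ConcreteCategory.congr_hom (K.toCycles_comp_homologyπ m n) g
  refine (map_smul (K.homologyπ n).hom r c).symm.trans ?_
  rw [← hc]
  exact h0

lemma isNoetherian_hom_of_ext_zero
    (h : IsNoetherian R ((P.complex.linearYonedaObj R Y).homology 0)) : IsNoetherian R (Z ⟶ Y) := by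
  let K := P.complex.linearYonedaObj R Y
  let φ : ModuleCat.of R (Z ⟶ Y) ⟶ K.X 0 := ((linearYoneda R _).obj Y).map (P.π.f 0).op
  have hφ : φ ≫ K.d 0 1 = 0 := by
    ext g
    change P.complex.d 1 0 ≫ P.π.f 0 ≫ g = 0
    exact (P.complex_d_comp_π_f_zero_assoc g).trans zero_comp
  let ψ := K.liftCycles φ 1 (by simp) hφ
  have hψ : Function.Injective ψ.hom := by
    intro g g' e
    have e1 := congrArg (K.iCycles 0).hom e
    have e2 := ConcreteCategory.congr_hom (K.liftCycles_i φ 1 (by simp) hφ)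
    have e3 : P.π.f 0 ≫ g = P.π.f 0 ≫ g' := (e2 g).symm.trans (e1.trans (e2 g'))
    exact (cancel_epi (P.π.f 0)).1 e3
  have hiso : IsIso (K.homologyπ 0) := K.isIso_homologyπ _ 0 rfl (by simp)
  have hinj : Function.Injective (K.homologyπ 0).hom :=
    (ModuleCat.mono_iff_injective (K.homologyπ 0)).1 inferInstance
  exact isNoetherian_of_injective ((K.homologyπ 0).hom ∘ₗ ψ.hom) (hinj.comp hψ)
end ExtFacts

/-- Over a commutative noetherian ring `R`, a module `X` is artinian if and only if there is a
proper ideal `a` of finite colength (`R/a` artinian) such that `X` is `a`-torsion and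
`Ext^i_R(R/a, X)` is finitely generated for all `i` (i.e. `X` is `a`-adically finite). -/
theorem artinian_iff_adically_finite_finite_colength
    (R : Type u) [CommRing R] [IsNoetherianRing R] [Nontrivial R]
    (X : Type u) [AddCommGroup X] [Module R X] :
    (∃ a : Ideal R, a ≠ ⊤ ∧ IsArtinianRing (R ⧸ a) ∧ IsAdicTorsion R a X ∧
      ∀ i : ℕ, Module.Finite R (extMod R i (R ⧸ a) X)) ↔ IsArtinian R X := by
  constructor
  · rintro ⟨a, -, hart, htor, hext⟩
    let Z := ModuleCat.of R (R ⧸ a)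
    let Y := ModuleCat.of R X
    have h0 : Module.Finite R (extMod R 0 (R ⧸ a) X) := hext 0
    have h1 : IsNoetherian R (extMod R 0 (R ⧸ a) X) := isNoetherian_of_isNoetherianRing_of_finite _ _
    let P := finRes Z
    have h2 : IsNoetherian R ((P.complex.linearYonedaObj R Y).homology 0) :=
      (LinearEquiv.isNoetherian_iff (P.isoExt (R := R) 0 Y).toLinearEquiv).1 h1
    have h3 := isNoetherian_hom_of_ext_zero P h2
    have h4 : IsNoetherian R ((R ⧸ a) →ₗ[R] X) :=
      (LinearEquiv.isNoetherian_iff (ModuleCat.homLinearEquiv (S := R) (M := Z) (N := Y))).1 h3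
    obtain ⟨S, hS⟩ := (IsNoetherian.noetherian a : a.FG)
    apply isArtinian_of_finset S
    · intro t ht x
      obtain ⟨n, hn⟩ := htor x
      exact ⟨n, hn _ (Ideal.pow_mem_pow (hS ▸ Submodule.subset_span ht) n)⟩
    · have hk : ∀ r ∈ a, ∀ x : Submodule.torsionBySet R X (S : Set R), r • x = 0 := by
        intro r hr x
        rw [← hS] at hr
        induction hr using Submodule.span_induction with
        | mem r hr => exact Subtype.ext ((Submodule.mem_torsionBySet_iff _ _).1 x.2 ⟨r, hr⟩)
        | zero => simp
        | add r s _ _ h h' => rw [add_smul, h, h', add_zero]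
        | smul c r _ h => rw [smul_assoc, h, smul_zero]
      rw [← isNoetherian_iff_isArtinian_of_killed a _ hk]
      let T := Submodule.torsionBySet R X (S : Set R)
      let ev : ((R ⧸ a) →ₗ[R] X) →ₗ[R] X := LinearMap.applyₗ (Ideal.Quotient.mk a 1)
      have hr : T ≤ LinearMap.range ev := by
        intro x hx
        have hle : a ≤ LinearMap.ker (LinearMap.toSpanSingleton R X x) := by
          intro r hr
          have := congrArg Subtype.val (hk r hr ⟨x, hx⟩)
          simpa using this
        refine ⟨a.liftQ (LinearMap.toSpanSingleton R X x) hle, ?_⟩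
        change (Submodule.liftQ a (LinearMap.toSpanSingleton R X x) hle)
          (Submodule.Quotient.mk 1) = x
        rw [Submodule.liftQ_apply]; simp
      have : IsNoetherian R (LinearMap.range ev) := inferInstance
      exact isNoetherian_of_le hr
  · intro hX
    obtain ⟨a, ha, hart, htor⟩ := exists_ideal_of_isArtinian (R := R) X
    refine ⟨a, ha, hart, htor, fun i => ?_⟩
    let Z := ModuleCat.of R (R ⧸ a)
    let Y := ModuleCat.of R X
    let P := finRes Z
    have hfin : Module.Finite R (P.complex.X i) :=
      finX_finite Z (inferInstanceAs (Module.Finite R (R ⧸ a))) i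
    have h1 := isArtinian_homology _ i (isArtinian_linearYonedaObj_X (Y := Y) P i hfin hX)
    have h2 := (isNoetherian_iff_isArtinian_of_killed a _ (fun r hr x =>
      killed_homology (Y := Y) P r (fun z => by
        obtain ⟨s, rfl⟩ := Ideal.Quotient.mk_surjective (I := a) z
        exact Ideal.Quotient.eq_zero_iff_mem.2 (a.mul_mem_right s hr)) i x)).2 h1
    have h3 : IsNoetherian R (extMod R i (R ⧸ a) X) :=
      (LinearEquiv.isNoetherian_iff (P.isoExt (R := R) i Y).toLinearEquiv).2 h2
    exact inferInstance

end
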